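/- arXiv:2506.16916 — 2 statements merged into one kernel-verified Lean document; each statement's English description precedes it below -/
import Mathlib

section
/- Let T > 0, H ∈ (1/2, 1), q ∈ ℕ (q ≥ 1), and 0 ≤ s ≤ t ≤ T. Then q! · ∫_{[0,T]^q} (L_t^{H,q}(x) - L_s^{H,q}(x))² dx = (t-s)^{2H}. -/
open MeasureTheory Real

/-- The Euler Beta function `B(a,b) = ∫_0^1 t^(a-1) (1-t)^(b-1) dt`. -/
noncomputable def betaFn (a b : ℝ) : ℝ := ∫ t in (0:ℝ)..1, t ^ (a - 1) * (1 - t) ^ (b - 1)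

/-- The normalizing constant `c_{H,q}` of the Hermite process of order `q`
and Hurst parameter `H`. -/
noncomputable def cHq (H : ℝ) (q : ℕ) : ℝ :=
  (H * (2 * H - 1) / ((q.factorial : ℝ) *
    betaFn (1/2 - (1 - H)/(q:ℝ)) (2 * (1 - H)/(q:ℝ)) ^ q)) ^ ((1:ℝ)/2)

/-- The kernel `L_t^{H,q}` of the finite-time-interval representation of the
Hermite process of order `q` and Hurst parameter `H`. -/
noncomputable def LHq (H : ℝ) (q : ℕ) (t : ℝ) : (Fin q → ℝ) → ℝ :=
  Set.indicator (Set.univ.pi fun _ : Fin q => Set.Ioo (0:ℝ) t)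
    (fun x => cHq H q * ∫ u in (⨆ i, x i)..t,
      ∏ i, (u / x i) ^ (1/2 - (1 - H)/(q:ℝ)) * (u - x i) ^ (-(1/2 + (1 - H)/(q:ℝ))))

section Aux

open Set

lemma lint_beta {a b : ℝ} (ha : 0 < a) (hb : 0 < b) :
    ∫⁻ x in Ioo (0:ℝ) 1, ENNReal.ofReal (x ^ (a - 1) * (1 - x) ^ (b - 1)) =
      ENNReal.ofReal (betaFn a b) ∧ 0 < betaFn a b := by
  have hB := ProbabilityTheory.beta_pos ha hb
  have h1 := ProbabilityTheory.lintegral_betaPDF_eq_one ha hb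
  rw [ProbabilityTheory.lintegral_betaPDF] at h1
  have h2 : ∫⁻ x in Ioo (0:ℝ) 1, ENNReal.ofReal (x ^ (a - 1) * (1 - x) ^ (b - 1)) =
      ENNReal.ofReal (ProbabilityTheory.beta a b) := by
    have h3 : ∫⁻ x in Ioo (0:ℝ) 1, ENNReal.ofReal (1 / ProbabilityTheory.beta a b * x ^ (a - 1) * (1 - x) ^ (b - 1)) = ENNReal.ofReal (1 / ProbabilityTheory.beta a b) *
        ∫⁻ x in Ioo (0:ℝ) 1, ENNReal.ofReal (x ^ (a - 1) * (1 - x) ^ (b - 1)) := by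
      rw [← lintegral_const_mul _ (by fun_prop)]
      congr 1 with x
      rw [mul_assoc, ENNReal.ofReal_mul (by positivity)]
    rw [h3] at h1
    have h4 : ENNReal.ofReal (ProbabilityTheory.beta a b) * ENNReal.ofReal (1 / ProbabilityTheory.beta a b) = 1 := by
      rw [← ENNReal.ofReal_mul hB.le, mul_one_div_cancel hB.ne', ENNReal.ofReal_one]
    calc _ = ENNReal.ofReal (ProbabilityTheory.beta a b) * ENNReal.ofReal (1 / ProbabilityTheory.beta a b) * _ := by rw [h4, one_mul]
      _ = _ := by rw [mul_assoc, h1, mul_one]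
  have h5 : betaFn a b = ProbabilityTheory.beta a b := by
    rw [betaFn, intervalIntegral.integral_of_le zero_le_one, integral_Ioc_eq_integral_Ioo,
      integral_eq_lintegral_of_nonneg_ae, h2, ENNReal.toReal_ofReal hB.le]
    · filter_upwards [ae_restrict_mem measurableSet_Ioo] with x hx
      have := hx.1
      have : 0 < 1 - x := by linarith [hx.2]
      simp only [Pi.zero_apply]
      positivity
    · apply Measurable.aestronglyMeasurable
      fun_prop
  rw [h5]
  exact ⟨h2, hB⟩

/-- The one-dimensional kernel, with values in the extended non-negative reals. -/
noncomputable def kk (a u x : ℝ) : ENNReal :=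
  if 0 < x ∧ x < u then ENNReal.ofReal ((u / x) ^ a * (u - x) ^ (a - 1)) else 0

lemma measurable_kk (a : ℝ) : Measurable (fun p : ℝ × ℝ => kk a p.1 p.2) := by
  unfold kk
  refine Measurable.ite ?_ (by fun_prop) (by fun_prop)
  exact (measurableSet_lt measurable_const measurable_snd).inter
    (measurableSet_lt measurable_snd measurable_fst)

@[fun_prop]
lemma measurable_kk' {α : Type*} [MeasurableSpace α] (a : ℝ) {f g : α → ℝ} (hf : Measurable f)
    (hg : Measurable g) : Measurable (fun p => kk a (f p) (g p)) :=
  (measurable_kk a).comp (hf.prodMk hg)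

lemma alg_id {a u v x p r w : ℝ} (hu : 0 < u) (hv : 0 < v) (hx : 0 < x) (hp : 0 < p)
    (hr : 0 < r) (hw : 0 < w) :
    v * w / (u * r ^ 2) * ((p * v / (u * r)) ^ (a - 1) * (x * w / (u * r)) ^ ((1 - 2 * a) - 1)) =
      (w ^ (1 - 2 * a)) * (((u / x) ^ a * p ^ (a - 1)) * ((v / x) ^ a * r ^ (a - 1))) := by
  obtain ⟨u, rfl⟩ : ∃ y, u = exp y := ⟨_, (exp_log hu).symm⟩
  obtain ⟨v, rfl⟩ : ∃ y, v = exp y := ⟨_, (exp_log hv).symm⟩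
  obtain ⟨x, rfl⟩ : ∃ y, x = exp y := ⟨_, (exp_log hx).symm⟩
  obtain ⟨p, rfl⟩ : ∃ y, p = exp y := ⟨_, (exp_log hp).symm⟩
  obtain ⟨r, rfl⟩ : ∃ y, r = exp y := ⟨_, (exp_log hr).symm⟩
  obtain ⟨w, rfl⟩ : ∃ y, w = exp y := ⟨_, (exp_log hw).symm⟩
  simp only [sq, ← exp_add, ← exp_sub, ← exp_mul]
  congr 1
  ring

lemma kk_lt {a u v : ℝ} (ha : 0 < a) (ha' : a < 1/2) (hu : 0 < u) (huv : u < v) :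
    ∫⁻ x, kk a u x * kk a v x =
      ENNReal.ofReal (betaFn a (1 - 2 * a) * (v - u) ^ (-(1 - 2 * a))) := by
  have hv : 0 < v := hu.trans huv
  have hw : 0 < v - u := by linarith
  obtain ⟨hB, hBpos⟩ := lint_beta ha (b := 1 - 2 * a) (by linarith)
  have him : (fun x => (u - x) * v / (u * (v - x))) '' Ioo 0 u = Ioo 0 1 := by
    ext y
    constructor
    · rintro ⟨x, ⟨h0, h1⟩, rfl⟩
      have : 0 < v - x := by linarith
      have h2 : 0 < u - x := by linarith
      refine ⟨by positivity, ?_⟩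
      rw [div_lt_one (by positivity)]
      nlinarith
    · rintro ⟨h0, h1⟩
      have h2 : 0 < v - u * y := by nlinarith
      have h3 : 0 < 1 - y := by linarith
      refine ⟨u * v * (1 - y) / (v - u * y), ⟨by positivity, ?_⟩, ?_⟩
      · rw [div_lt_iff₀ h2]; nlinarith [mul_pos (mul_pos hu h0) hw]
      · have h4 : v - u * v * (1 - y) / (v - u * y) = v * (v - u) / (v - u * y) := by
          field_simp; ring
        have h5 : u - u * v * (1 - y) / (v - u * y) = u * y * (v - u) / (v - u * y) := by
          field_simp; ring
        simp only [h4, h5]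
        field_simp
  have hinj : InjOn (fun x => (u - x) * v / (u * (v - x))) (Ioo 0 u) := by
    intro x hx y hy hxy
    have h1 : 0 < v - x := by linarith [hx.2]
    have h2 : 0 < v - y := by linarith [hy.2]
    simp only at hxy
    rw [div_eq_div_iff (by positivity) (by positivity)] at hxy
    have : u * v * (v - u) * (x - y) = 0 := by linear_combination -hxy
    have h3 : u * v * (v - u) ≠ 0 := by positivity
    have := (mul_eq_zero.1 this).resolve_left h3
    linarith
  have hder : ∀ x ∈ Ioo 0 u, HasDerivWithinAt (fun x => (u - x) * v / (u * (v - x)))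
      (-(v * (v - u) / (u * (v - x) ^ 2))) (Ioo 0 u) x := by
    intro x hx
    have h1 : 0 < v - x := by linarith [hx.2]
    have := (((hasDerivAt_id x).const_sub u).mul_const v).div
      (((hasDerivAt_id x).const_sub v).const_mul u) (by simp only [id]; positivity)
    refine (this.congr_deriv ?_).hasDerivWithinAt
    simp only [id]
    field_simp
    ring
  have key := lintegral_image_eq_lintegral_abs_deriv_mul measurableSet_Ioo hder hinj
    (fun y => ENNReal.ofReal (y ^ (a - 1) * (1 - y) ^ ((1 - 2 * a) - 1)))
  rw [him, hB] at key
  have h1 : ∫⁻ x, kk a u x * kk a v x = ∫⁻ x in Ioo 0 u, kk a u x * kk a v x := by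
    rw [← lintegral_indicator measurableSet_Ioo]
    congr 1 with x
    by_cases hx : x ∈ Ioo 0 u
    · simp [hx]
    · rw [indicator_of_notMem hx, kk, if_neg (by exact hx), zero_mul]
  have h2 : ENNReal.ofReal (betaFn a (1 - 2 * a)) =
      ENNReal.ofReal ((v - u) ^ (1 - 2 * a)) * ∫⁻ x in Ioo 0 u, kk a u x * kk a v x := by
    rw [key, ← lintegral_const_mul _ (by fun_prop)]
    refine setLIntegral_congr_fun measurableSet_Ioo fun x hx => ?_
    have h3 : 0 < v - x := by linarith [hx.2]
    have h4 : 0 < u - x := by linarith [hx.2]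
    have h5 : 0 < x := hx.1
    have h6 : 1 - (u - x) * v / (u * (v - x)) = x * (v - u) / (u * (v - x)) := by
      field_simp; ring
    simp only [kk]
    rw [if_pos (show 0 < x ∧ x < u from hx), if_pos ⟨hx.1, hx.2.trans huv⟩, abs_neg, abs_of_pos (by positivity), h6,
      ← ENNReal.ofReal_mul (by positivity), alg_id hu hv h5 h4 h3 hw,
      ENNReal.ofReal_mul (by positivity), ENNReal.ofReal_mul (by positivity)]
  rw [h1, mul_comm (betaFn _ _), ENNReal.ofReal_mul (by positivity), h2, ← mul_assoc,
    ← ENNReal.ofReal_mul (by positivity), ← rpow_add hw]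
  simp

lemma kk_ne {a u v : ℝ} (ha : 0 < a) (ha' : a < 1/2) (hu : 0 < u) (hv : 0 < v) (huv : u ≠ v) :
    ∫⁻ x, kk a u x * kk a v x =
      ENNReal.ofReal (betaFn a (1 - 2 * a) * |u - v| ^ (-(1 - 2 * a))) := by
  rcases lt_or_gt_of_ne huv with h | h
  · rw [kk_lt ha ha' hu h, abs_sub_comm, abs_of_pos (sub_pos.2 h)]
  · simp_rw [mul_comm (kk a u _)]
    rw [kk_lt ha ha' hv h, abs_of_pos (sub_pos.2 h)]

lemma lint_prod (n : ℕ) (f : ℝ → ENNReal) (hf : Measurable f) :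
    ∫⁻ x : Fin n → ℝ, ∏ i, f (x i) = (∫⁻ x, f x) ^ n := by
  induction n with
  | zero => simp [volume_pi]
  | succ n ih =>
    rw [(volume_preserving_piFinSuccAbove (fun _ : Fin (n+1) => ℝ) 0).symm.lintegral_map_equiv]
    simp_rw [MeasurableEquiv.piFinSuccAbove_symm_apply, Fin.insertNthEquiv,
            Fin.prod_univ_succ, Fin.insertNth_zero, Equiv.coe_fn_mk, Fin.cons_succ,
            Fin.cons_zero]
    have := lintegral_prod_mul (μ := (volume : Measure ℝ)) (ν := (volume : Measure (Fin n → ℝ)))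
      (f := f) (g := fun x => ∏ i, f (x i)) hf.aemeasurable
      (Finset.measurable_prod _ fun i _ => hf.comp (measurable_pi_apply i)).aemeasurable
    rw [pow_succ', ← ih, ← this]
    rfl

lemma lint_left {p s u : ℝ} (hp : -1 < p) (hsu : s ≤ u) :
    ∫⁻ v in Ioc s u, ENNReal.ofReal (|u - v| ^ p) = ENNReal.ofReal ((u - s) ^ (p + 1) / (p + 1)) := by
  have hi : IntervalIntegrable (fun v => |u - v| ^ p) volume s u := by
    have h := (intervalIntegral.intervalIntegrable_rpow' hp (a := 0) (b := u - s)).abs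
    have h2 := (h.comp_sub_left u).symm
    simp only [sub_zero, sub_sub_cancel] at h2
    refine h2.congr ?_
    intro v hv
    rw [uIoc_of_le hsu] at hv
    have : 0 ≤ u - v := by linarith [hv.2]
    simp only
    rw [abs_of_nonneg this, abs_of_nonneg (by positivity)]
  rw [← ofReal_integral_eq_lintegral_ofReal
    ((intervalIntegrable_iff_integrableOn_Ioc_of_le hsu).1 hi) (ae_of_all _ fun v => by positivity),
    ← intervalIntegral.integral_of_le hsu]
  congr 1
  rw [intervalIntegral.integral_comp_sub_left (fun v => |v| ^ p) u, sub_self]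
  rw [intervalIntegral.integral_congr (g := fun v => v ^ p), integral_rpow (Or.inl hp),
    zero_rpow (by linarith), sub_zero]
  intro v hv
  rw [uIcc_of_le (by linarith)] at hv
  simp only
  rw [abs_of_nonneg hv.1]

lemma lint_right {p t u : ℝ} (hp : -1 < p) (hut : u ≤ t) :
    ∫⁻ v in Ioc u t, ENNReal.ofReal (|u - v| ^ p) = ENNReal.ofReal ((t - u) ^ (p + 1) / (p + 1)) := by
  rw [setLIntegral_congr (Ico_ae_eq_Ioc (μ := volume)).symm]
  have h := lint_left hp (show -t ≤ -u by linarith)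
  have h3 := (Measure.measurePreserving_neg (volume : Measure ℝ)).setLIntegral_comp_preimage
    (s := Ioc (-t) (-u)) measurableSet_Ioc
    (f := fun v => ENNReal.ofReal (|-u - v| ^ p)) (by fun_prop)
  rw [h] at h3
  have h4 : Neg.neg ⁻¹' Ioc (-t) (-u) = Ico u t := by
    ext; simp [and_comm]
  rw [h4] at h3
  convert h3 using 4
  · rename_i v
    rw [← abs_neg]; congr 2; ring
  · ring

lemma lint_double {p s t : ℝ} (hp : -1 < p) (hst : s ≤ t) :
    ∫⁻ u in Ioc s t, ∫⁻ v in Ioc s t, ENNReal.ofReal (|u - v| ^ p) =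
      ENNReal.ofReal (2 * (t - s) ^ (p + 2) / ((p + 1) * (p + 2))) := by
  have hp1 : 0 < p + 1 := by linarith
  have h1 : ∀ u ∈ Ioc s t, ∫⁻ v in Ioc s t, ENNReal.ofReal (|u - v| ^ p) =
      ENNReal.ofReal (1 / (p + 1)) * (ENNReal.ofReal (|s - u| ^ (p + 1)) + ENNReal.ofReal (|t - u| ^ (p + 1))) := by
    intro u hu
    have e1 : 0 ≤ u - s := by linarith [hu.1]
    have e2 : 0 ≤ t - u := by linarith [hu.2]
    rw [← Ioc_union_Ioc_eq_Ioc hu.1.le hu.2, lintegral_union measurableSet_Ioc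
      (Ioc_disjoint_Ioc_of_le le_rfl), lint_left hp hu.1.le, lint_right hp hu.2,
      abs_sub_comm, abs_of_nonneg e1, abs_of_nonneg e2, mul_add, ← ENNReal.ofReal_mul (by positivity),
      ← ENNReal.ofReal_mul (by positivity)]
    congr 2 <;> ring
  rw [setLIntegral_congr_fun measurableSet_Ioc h1, lintegral_const_mul _ (by fun_prop),
    lintegral_add_left (by fun_prop), lint_left (by linarith) hst, lint_right (by linarith) hst,
    ← ENNReal.ofReal_add, ← ENNReal.ofReal_mul (by positivity)]
  · congr 1
    rw [show p + 1 + 1 = p + 2 by ring]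
    field_simp
    ring
  all_goals
    have : 0 ≤ t - s := by linarith
    have : 0 < p + 1 + 1 := by linarith
    positivity

/-- The extended non-negative version of the increment of the kernel. -/
noncomputable def DD (q : ℕ) (a s t : ℝ) (x : Fin q → ℝ) : ENNReal :=
  ∫⁻ u in Ioc s t, ∏ i, kk a u (x i)

lemma measurable_prodkk (q : ℕ) (a : ℝ) :
    Measurable (fun z : (Fin q → ℝ) × ℝ => ∏ i, kk a z.2 (z.1 i)) :=
  Finset.measurable_prod _ fun i _ => measurable_kk' a measurable_snd
    ((measurable_pi_apply i).comp measurable_fst)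

lemma measurable_prodkk' (q : ℕ) (a : ℝ) (x : Fin q → ℝ) :
    Measurable (fun u : ℝ => ∏ i, kk a u (x i)) :=
  (measurable_prodkk q a).comp (measurable_const.prodMk measurable_id)

lemma measurable_DD (q : ℕ) (a s t : ℝ) : Measurable (DD q a s t) :=
  (measurable_prodkk q a).lintegral_prod_right

lemma lint_DD (q : ℕ) {a s t : ℝ} (ha : 0 < a) (ha' : a < 1/2) (hs : 0 ≤ s) (hst : s ≤ t)
    (hp : -1 < -(1 - 2 * a) * q) :
    ∫⁻ x, DD q a s t x ^ 2 = ENNReal.ofReal (betaFn a (1 - 2 * a) ^ q *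
      (2 * (t - s) ^ (-(1 - 2 * a) * q + 2) /
        ((-(1 - 2 * a) * q + 1) * (-(1 - 2 * a) * q + 2)))) := by
  have hB := (lint_beta ha (b := 1 - 2 * a) (by linarith)).2
  have h1 : ∀ x, DD q a s t x ^ 2 =
      ∫⁻ z, (∏ i, kk a z.1 (x i)) * (∏ i, kk a z.2 (x i))
        ∂((volume.restrict (Ioc s t)).prod (volume.restrict (Ioc s t))) := by
    intro x
    rw [lintegral_prod_mul (measurable_prodkk' q a x).aemeasurable
      (measurable_prodkk' q a x).aemeasurable, sq]
    rfl
  have hm : Measurable (fun y : (Fin q → ℝ) × (ℝ × ℝ) =>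
      (∏ i, kk a y.2.1 (y.1 i)) * (∏ i, kk a y.2.2 (y.1 i))) :=
    ((measurable_prodkk q a).comp (measurable_fst.prodMk (measurable_fst.comp measurable_snd))).mul
    ((measurable_prodkk q a).comp (measurable_fst.prodMk (measurable_snd.comp measurable_snd)))
  simp_rw [h1]
  rw [lintegral_lintegral_swap hm.aemeasurable, lintegral_prod]
  swap
  · exact hm.lintegral_prod_left'.aemeasurable
  rw [ENNReal.ofReal_mul (by positivity), ← lint_double hp hst, ← lintegral_const_mul]
  swap
  · have : Measurable (fun z : ℝ × ℝ => ENNReal.ofReal (|z.1 - z.2| ^ (-(1 - 2 * a) * q))) := by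
      fun_prop
    exact this.lintegral_prod_right
  refine setLIntegral_congr_fun measurableSet_Ioc fun u hu => ?_
  simp only
  rw [← lintegral_const_mul _ (by fun_prop)]
  refine lintegral_congr_ae ?_
  have hne : ∀ᵐ v ∂(volume.restrict (Ioc s t)), v ≠ u :=
    ae_restrict_of_ae (by simp [ae_iff])
  filter_upwards [hne, ae_restrict_mem measurableSet_Ioc] with v hv hvm
  simp_rw [← Finset.prod_mul_distrib]
  rw [lint_prod q (fun y => kk a u y * kk a v y) (by fun_prop),
    kk_ne ha ha' (by linarith [hu.1]) (by linarith [hvm.1]) hv.symm,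
    ← ENNReal.ofReal_pow (by positivity), mul_pow, ENNReal.ofReal_mul (by positivity),
    ← rpow_mul_natCast (abs_nonneg _)]

lemma DD_add (q : ℕ) (a : ℝ) {s t : ℝ} (hs : 0 ≤ s) (hst : s ≤ t) (x : Fin q → ℝ) :
    DD q a 0 t x = DD q a 0 s x + DD q a s t x := by
  unfold DD
  rw [← Ioc_union_Ioc_eq_Ioc hs hst, lintegral_union measurableSet_Ioc
      (Ioc_disjoint_Ioc_of_le le_rfl)]

lemma LHq_eq (H : ℝ) (q : ℕ) (hq : 1 ≤ q) (t : ℝ) (x : Fin q → ℝ) :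
    LHq H q t x = cHq H q * (DD q (1/2 - (1 - H)/(q:ℝ)) 0 t x).toReal := by
  have : Nonempty (Fin q) := ⟨⟨0, hq⟩⟩
  set a := 1/2 - (1 - H)/(q:ℝ) with ha
  have ha1 : -(1/2 + (1 - H)/(q:ℝ)) = a - 1 := by rw [ha]; ring
  unfold LHq
  rw [ha1, ← ha]
  by_cases hx : x ∈ Set.univ.pi fun _ : Fin q => Set.Ioo (0:ℝ) t
  · rw [indicator_of_mem hx]
    have hx' : ∀ i, 0 < x i ∧ x i < t := fun i => hx i (mem_univ i)
    obtain ⟨j, hj⟩ := exists_eq_ciSup_of_finite (f := x)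
    have hle : ∀ i, x i ≤ x j := fun i => hj ▸ le_ciSup (Set.finite_range x).bddAbove i
    rw [← hj]
    congr 1
    rw [intervalIntegral.integral_of_le (hx' j).2.le, integral_eq_lintegral_of_nonneg_ae]
    · congr 1
      unfold DD
      rw [← Ioc_union_Ioc_eq_Ioc (hx' j).1.le (hx' j).2.le, lintegral_union measurableSet_Ioc
        (Ioc_disjoint_Ioc_of_le le_rfl)]
      have h0 : ∫⁻ u in Ioc 0 (x j), ∏ i, kk a u (x i) = 0 := by
        refine setLIntegral_eq_zero measurableSet_Ioc fun u hu => ?_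
        refine Finset.prod_eq_zero (Finset.mem_univ j) ?_
        rw [kk, if_neg (fun h => absurd hu.2 (not_le.2 h.2))]
      rw [h0, zero_add]
      refine setLIntegral_congr_fun measurableSet_Ioc fun u hu => ?_
      rw [ENNReal.ofReal_prod_of_nonneg]
      · refine Finset.prod_congr rfl fun i _ => ?_
        rw [kk, if_pos ⟨(hx' i).1, (hle i).trans_lt hu.1⟩]
      · intro i _
        have h1 := (hx' i).1
        have h2 : 0 < u - x i := by linarith [hle i, hu.1]
        have h3 : 0 < u := by linarith
        positivity
    · filter_upwards [ae_restrict_mem measurableSet_Ioc] with u hu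
      refine Finset.prod_nonneg fun i _ => ?_
      have h1 := (hx' i).1
      have h2 : 0 < u - x i := by linarith [hle i, hu.1]
      have h3 : 0 < u := by linarith
      positivity
    · apply Measurable.aestronglyMeasurable
      fun_prop
  · rw [indicator_of_notMem hx]
    have h0 : DD q a 0 t x = 0 := by
      refine setLIntegral_eq_zero measurableSet_Ioc fun u hu => ?_
      simp only [mem_pi, not_forall] at hx
      obtain ⟨i, _, hi⟩ := hx
      refine Finset.prod_eq_zero (Finset.mem_univ i) ?_
      rw [kk, if_neg (fun h => hi ⟨h.1, h.2.trans_le hu.2⟩)]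
    rw [h0]; simp

lemma main_aux (T H : ℝ) (hH : H ∈ Set.Ioo (1/2:ℝ) 1)
    (q : ℕ) (hq : 1 ≤ q) (s t : ℝ) (hs : 0 ≤ s) (hst : s ≤ t) (ht : t ≤ T) :
    (q.factorial : ℝ) *
      (∫ x in Set.univ.pi fun _ : Fin q => Set.Icc (0:ℝ) T, (LHq H q t x - LHq H q s x) ^ 2) =
      (t - s) ^ (2*H) := by
  obtain ⟨hH1, hH2⟩ := hH
  have hq0 : (1:ℝ) ≤ q := by exact_mod_cast hq
  have hqp : (0:ℝ) < q := by linarith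
  rw [setIntegral_eq_integral_of_forall_compl_eq_zero]
  swap
  · intro x hx
    have h : ∀ r, r ≤ T → LHq H q r x = 0 := by
      intro r hr
      refine indicator_of_notMem (fun h => hx ?_) _
      intro i hi
      exact ⟨(h i hi).1.le, (h i hi).2.le.trans hr⟩
    rw [h t ht, h s (hst.trans ht)]; simp
  simp_rw [LHq_eq H q hq]
  have hb : 2 * (1 - H) / (q:ℝ) = 1 - 2 * (1/2 - (1 - H)/(q:ℝ)) := by ring
  have hc : cHq H q ^ 2 = H * (2 * H - 1) / ((q.factorial : ℝ) *
    betaFn (1/2 - (1 - H)/(q:ℝ)) (1 - 2 * (1/2 - (1 - H)/(q:ℝ))) ^ q) ∧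
    0 < betaFn (1/2 - (1 - H)/(q:ℝ)) (1 - 2 * (1/2 - (1 - H)/(q:ℝ))) := by
    have hd : (1 - H) / q < 1/2 := by
      rw [div_lt_iff₀ hqp]; nlinarith
    have hd' : 0 < (1 - H) / q := div_pos (by linarith) hqp
    have hB := (lint_beta (a := 1/2 - (1 - H)/(q:ℝ)) (b := 1 - 2 * (1/2 - (1 - H)/(q:ℝ)))
      (by linarith) (by linarith)).2
    refine ⟨?_, hB⟩
    unfold cHq
    rw [hb, ← sqrt_eq_rpow, sq_sqrt]
    have : 0 < 2 * H - 1 := by linarith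
    positivity
  have ha : 0 < 1/2 - (1 - H)/(q:ℝ) := by
    have hd : (1 - H) / q < 1/2 := by
      rw [div_lt_iff₀ hqp]; nlinarith
    linarith
  have ha' : 1/2 - (1 - H)/(q:ℝ) < 1/2 := by
    have hd' : 0 < (1 - H) / q := div_pos (by linarith) hqp
    linarith
  have hpq : -(1 - 2 * (1/2 - (1 - H)/(q:ℝ))) * q = 2 * H - 2 := by
    field_simp; ring
  set a := 1/2 - (1 - H)/(q:ℝ)
  obtain ⟨hc, hB⟩ := hc
  have hfin : ∀ s t : ℝ, 0 ≤ s → s ≤ t → ∀ᵐ x, DD q a s t x < ⊤ := by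
    intro s t hs hst
    have := ae_lt_top (μ := volume) ((measurable_DD q a s t).pow_const 2) (by
      rw [lint_DD q ha ha' hs hst (by rw [hpq]; linarith)]; exact ENNReal.ofReal_ne_top)
    filter_upwards [this] with x hx
    by_contra h
    simp only [not_lt, top_le_iff] at h
    simp [h] at hx
  have hcongr : ∀ᵐ x, (cHq H q * (DD q a 0 t x).toReal - cHq H q * (DD q a 0 s x).toReal) ^ 2 =
      cHq H q ^ 2 * (DD q a s t x ^ 2).toReal := by
    filter_upwards [hfin 0 s le_rfl hs, hfin s t hs hst] with x h1 h2
    rw [DD_add q a hs hst, ENNReal.toReal_add h1.ne h2.ne, ENNReal.toReal_pow]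
    ring
  rw [integral_congr_ae hcongr, integral_const_mul, integral_toReal, lint_DD q ha ha' hs hst
    (by rw [hpq]; linarith), hpq, hc, ENNReal.toReal_ofReal]
  · have h1 : 2 * H - 1 ≠ 0 := by linarith
    have h2 : H ≠ 0 := by linarith
    have h3 : (q.factorial : ℝ) ≠ 0 := by positivity
    rw [show 2 * H - 2 + 2 = 2 * H by ring, show 2 * H - 2 + 1 = 2 * H - 1 by ring]
    generalize (t - s) ^ (2 * H) = Y
    generalize 2 * H - 1 = W at h1 ⊢
    field_simp
  · have : 0 ≤ t - s := by linarith
    have : 0 < 2 * H - 2 + 1 := by linarith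
    have : 0 < 2 * H - 2 + 2 := by linarith
    positivity
  · exact ((measurable_DD q a s t).pow_const 2).aemeasurable
  · filter_upwards [hfin s t hs hst] with x hx
    exact ENNReal.pow_lt_top hx

end Aux

/-- For `T > 0`, `H ∈ (1/2,1)`, `q ≥ 1` and `0 ≤ s ≤ t ≤ T`,
`q! ∫_{[0,T]^q} (L_t^{H,q}(x) - L_s^{H,q}(x))² dx = (t-s)^{2H}`. -/
theorem stmt_4 (T H : ℝ) (hT : 0 < T) (hH : H ∈ Set.Ioo (1/2:ℝ) 1)
    (q : ℕ) (hq : 1 ≤ q) (s t : ℝ) (hs : 0 ≤ s) (hst : s ≤ t) (ht : t ≤ T) :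
    (q.factorial : ℝ) *
      (∫ x in Set.univ.pi fun _ : Fin q => Set.Icc (0:ℝ) T, (LHq H q t x - LHq H q s x) ^ 2) =
      (t - s) ^ (2*H) := by
  exact main_aux T H hH q hq s t hs hst ht
end

section
/- Let T > 0, H ∈ (1/2, 1), q ∈ ℕ with q ≥ 2, set H' := 1 + (H-1)/q, and let 0 ≤ s < t ≤ T. Then for almost every (x, y) ∈ [0,T]², ∫_{[0,T]^{q-1}} L_{s,t}^{H,q}(x, z₁,…,z_{q-1}) · L_{s,t}^{H,q}(y, z₁,…,z_{q-1}) dz₁…dz_{q-1} = c_{H,q}² · B(H'-1/2, 2-2H')^{q-1} · ∫_s^t ∫_s^t k^{H'}(u,x) k^{H'}(v,y) |u-v|^{(2H'-2)(q-1)} du dv. -/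
open MeasureTheory Real

/-- The vector `(x, z₁, …, z_{q-1}) ∈ ℝ^q` built from `x ∈ ℝ` and `z ∈ ℝ^{q-1}`. -/
def consVec {q : ℕ} (hq : 1 ≤ q) (x : ℝ) (z : Fin (q - 1) → ℝ) : Fin q → ℝ :=
  fun i => Matrix.vecCons x z (Fin.cast (show q = q - 1 + 1 by omega) i)

/-- The kernel `k^{H'}(u,x) = (u/x)^{H'-1/2} (u-x)_+^{H'-3/2}`. -/
noncomputable def kKer (H' u x : ℝ) : ℝ :=
  (u / x) ^ (H' - 1/2) * (max (u - x) 0) ^ (H' - 3/2)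

lemma beta_integrableOn {a b : ℝ} (ha : 0 < a) (hb : 0 < b) :
    IntegrableOn (fun t : ℝ => t ^ (a - 1) * (1 - t) ^ (b - 1)) (Set.Ioo 0 1) := by
  have h := Complex.betaIntegral_convergent (u := (a : ℂ)) (v := (b : ℂ)) (by simpa) (by simpa)
  rw [intervalIntegrable_iff_integrableOn_Ioo_of_le zero_le_one] at h
  have h2 := h.norm
  refine h2.congr ?_
  filter_upwards [ae_restrict_mem measurableSet_Ioo] with t ht
  have h1 : (1 - (t:ℂ)) = ((1 - t : ℝ) : ℂ) := by push_cast; rfl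
  rw [norm_mul, h1, Complex.norm_cpow_eq_rpow_re_of_pos ht.1,
    Complex.norm_cpow_eq_rpow_re_of_pos (by linarith [ht.2])]
  simp

lemma beta_lintegral {a b : ℝ} (ha : 0 < a) (hb : 0 < b) :
    ∫⁻ t in Set.Ioo (0:ℝ) 1, ENNReal.ofReal (t ^ (a - 1) * (1 - t) ^ (b - 1))
      = ENNReal.ofReal (betaFn a b) := by
  rw [betaFn, intervalIntegral.integral_of_le zero_le_one, integral_Ioc_eq_integral_Ioo,
    ofReal_integral_eq_lintegral_ofReal (beta_integrableOn ha hb)]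
  filter_upwards [ae_restrict_mem measurableSet_Ioo] with t ht
  have := ht.1
  have : 0 < 1 - t := by linarith [ht.2]
  simp only [Pi.zero_apply]
  positivity

lemma betaFn_nonneg (a b : ℝ) : 0 ≤ betaFn a b := by
  rw [betaFn]
  refine intervalIntegral.integral_nonneg zero_le_one fun t ht => ?_
  have := ht.1
  have : 0 ≤ 1 - t := by linarith [ht.2]
  positivity

lemma kKer_nonneg {H' u x : ℝ} (hu : 0 ≤ u) (hx : 0 ≤ x) : 0 ≤ kKer H' u x := by
  unfold kKer
  positivity

lemma kKer_eq_zero {H' u x : ℝ} (hH : H' < 3/2) (h : u ≤ x) : kKer H' u x = 0 := by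
  unfold kKer
  rw [max_eq_right (by linarith), Real.zero_rpow (by linarith), mul_zero]

lemma kKer_of_lt {H' u x : ℝ} (h : x < u) :
    kKer H' u x = (u / x) ^ (H' - 1/2) * (u - x) ^ (H' - 3/2) := by
  unfold kKer
  rw [max_eq_left (by linarith)]

lemma measurable_kKer (H' : ℝ) : Measurable (fun p : ℝ × ℝ => kKer H' p.1 p.2) := by
  unfold kKer
  fun_prop

/-- the kernel, valued in the extended nonnegative reals -/
noncomputable def kE (H' u x : ℝ) : ENNReal := ENNReal.ofReal (kKer H' u x)

lemma measurable_kE (H' : ℝ) : Measurable (fun p : ℝ × ℝ => kE H' p.1 p.2) :=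
  (measurable_kKer H').ennreal_ofReal

@[fun_prop]
lemma measurable_kE_comp {α : Type*} [MeasurableSpace α] (H' : ℝ) {f g : α → ℝ}
    (hf : Measurable f) (hg : Measurable g) : Measurable (fun p => kE H' (f p) (g p)) :=
  (measurable_kE H').comp (hf.prodMk hg)

lemma lintegral_kE {H' T u : ℝ} (h1 : 1/2 < H') (h2 : H' < 1) (hu : 0 < u) (huT : u ≤ T) :
    ∫⁻ z in Set.Ioo (0:ℝ) T, kE H' u z =
      ENNReal.ofReal (u ^ (H' - 1/2)) * ENNReal.ofReal (betaFn (3/2 - H') (H' - 1/2)) := by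
  have hsub : ∫⁻ z in Set.Ioo (0:ℝ) T, kE H' u z = ∫⁻ z in Set.Ioo (0:ℝ) u, kE H' u z := by
    symm
    rw [← Set.inter_eq_self_of_subset_left (Set.Ioo_subset_Ioo_right huT), 
      ← setLIntegral_indicator measurableSet_Ioo]
    refine setLIntegral_congr_fun measurableSet_Ioo fun z hz => ?_
    by_cases hzu : z < u
    · simp [Set.indicator, hz.1, hzu]
    · simp [Set.indicator, hzu, kE, kKer_eq_zero (by linarith : H' < 3/2) (not_lt.1 hzu)]
  rw [hsub, ← beta_lintegral (by linarith) (by linarith)]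
  have himg : (fun z => z / u) '' Set.Ioo 0 u = Set.Ioo 0 1 := by
    ext w
    constructor
    · rintro ⟨z, hz, rfl⟩
      exact ⟨div_pos hz.1 hu, (div_lt_one hu).2 hz.2⟩
    · rintro ⟨hw0, hw1⟩
      exact ⟨w * u, ⟨by positivity, by nlinarith⟩, by field_simp⟩
  rw [← himg, lintegral_image_eq_lintegral_abs_deriv_mul (f := fun z => z / u)
    (f' := fun _ => 1 / u) measurableSet_Ioo
    (fun x _ => ((hasDerivAt_id x).div_const u).hasDerivWithinAt)
    (fun x _ y _ h => by field_simp at h; exact h), ← lintegral_const_mul' _ _ ENNReal.ofReal_ne_top]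
  refine setLIntegral_congr_fun measurableSet_Ioo fun z hz => ?_
  have hz0 := hz.1
  have hz1 : 0 < u - z := by linarith [hz.2]
  have e : 1 - z / u = (u - z) / u := by field_simp
  simp only [kE, kKer_of_lt hz.2]
  rw [e, ← ENNReal.ofReal_mul (by positivity), ← ENNReal.ofReal_mul (by positivity)]
  congr 1
  rw [abs_of_pos (by positivity)]
  apply Real.log_injOn_pos (Set.mem_Ioi.2 (by positivity)) (Set.mem_Ioi.2 (by positivity))
  have n1 := hu.ne'
  have n2 := hz0.ne'
  have n3 := hz1.ne'
  rw [Real.log_mul (by positivity) (by positivity), Real.log_mul (by positivity) (by positivity),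
    Real.log_mul (by positivity) (by positivity), Real.log_mul (by positivity) (by positivity),
    Real.log_rpow (by positivity), Real.log_rpow (by positivity), Real.log_rpow (by positivity),
    Real.log_rpow (by positivity), Real.log_rpow (by positivity), Real.log_div n1 n2,
    Real.log_div n2 n1, Real.log_div n3 n1, Real.log_div one_ne_zero n1, Real.log_one]
  ring

lemma lintegral_kE_kE_aux {H' T u v : ℝ} (h1 : 1/2 < H') (h2 : H' < 1) (hu : 0 < u) (huv : u < v)
    (huT : u ≤ T) :
    ∫⁻ z in Set.Ioo (0:ℝ) T, kE H' u z * kE H' v z =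
      ENNReal.ofReal (betaFn (H' - 1/2) (2 - 2 * H') * (v - u) ^ (2 * H' - 2)) := by
  have hsub : ∫⁻ z in Set.Ioo (0:ℝ) T, kE H' u z * kE H' v z
      = ∫⁻ z in Set.Ioo (0:ℝ) u, kE H' u z * kE H' v z := by
    symm
    rw [← Set.inter_eq_self_of_subset_left (Set.Ioo_subset_Ioo_right huT), 
      ← setLIntegral_indicator measurableSet_Ioo]
    refine setLIntegral_congr_fun measurableSet_Ioo fun z hz => ?_
    by_cases hzu : z < u
    · simp [Set.indicator, hz.1, hzu]
    · simp [Set.indicator, hzu, kE, kKer_eq_zero (by linarith : H' < 3/2) (not_lt.1 hzu)]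
  have hv : 0 < v := hu.trans huv
  have hd : 0 < v - u := by linarith
  rw [hsub, mul_comm, ENNReal.ofReal_mul (by positivity),
    ← beta_lintegral (by linarith) (by linarith)]
  have himg : (fun z => v * (u - z) / (u * (v - z))) '' Set.Ioo 0 u = Set.Ioo 0 1 := by
    ext w
    constructor
    · rintro ⟨z, hz, rfl⟩
      have hz0 := hz.1
      have hz1 : 0 < u - z := by linarith [hz.2]
      have hz2 : 0 < v - z := by linarith [hz.2]
      refine ⟨by positivity, (div_lt_one (by positivity)).2 ?_⟩
      nlinarith
    · rintro ⟨hw0, hw1⟩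
      have hp : 0 < v - u * w := by nlinarith
      have hp1 : 0 < 1 - w := by linarith
      refine ⟨u * v * (1 - w) / (v - u * w), ⟨by positivity, ?_⟩, ?_⟩
      · rw [div_lt_iff₀ hp]
        nlinarith [mul_pos (mul_pos hu hw0) hd]
      · have e1 : u - u * v * (1 - w) / (v - u * w) = u * w * (v - u) / (v - u * w) := by
          field_simp; ring
        have e2 : v - u * v * (1 - w) / (v - u * w) = v * (v - u) / (v - u * w) := by
          field_simp; ring
        simp only [e1, e2]
        field_simp
  have hder : ∀ z ∈ Set.Ioo 0 u, HasDerivWithinAt (fun z => v * (u - z) / (u * (v - z)))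
      (-(v * (v - u) / (u * (v - z) ^ 2))) (Set.Ioo 0 u) z := by
    intro z hz
    have hz2 : 0 < v - z := by linarith [hz.2]
    have ha : HasDerivAt (fun z => v * (u - z)) (v * (0 - 1)) z :=
      (((hasDerivAt_const z u).sub (hasDerivAt_id z))).const_mul v
    have hb : HasDerivAt (fun z => u * (v - z)) (u * (0 - 1)) z :=
      (((hasDerivAt_const z v).sub (hasDerivAt_id z))).const_mul u
    refine HasDerivAt.hasDerivWithinAt ((ha.div hb (by positivity)).congr_deriv ?_)
    field_simp
    ring
  have hinj : Set.InjOn (fun z => v * (u - z) / (u * (v - z))) (Set.Ioo 0 u) := by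
    intro x hx y hy h
    have hx2 : 0 < v - x := by linarith [hx.2]
    have hy2 : 0 < v - y := by linarith [hy.2]
    simp only at h
    rw [div_eq_div_iff (by positivity) (by positivity)] at h
    have : u * v * (v - u) * (x - y) = 0 := by linarith
    have h3 : u * v * (v - u) ≠ 0 := by positivity
    have := (mul_eq_zero.1 this).resolve_left h3
    linarith
  rw [← himg, lintegral_image_eq_lintegral_abs_deriv_mul measurableSet_Ioo hder hinj,
    ← lintegral_const_mul' _ _ ENNReal.ofReal_ne_top]
  refine setLIntegral_congr_fun measurableSet_Ioo fun z hz => ?_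
  have hz0 := hz.1
  have hz1 : 0 < u - z := by linarith [hz.2]
  have hz2 : 0 < v - z := by linarith [hz.2]
  have e : 1 - v * (u - z) / (u * (v - z)) = z * (v - u) / (u * (v - z)) := by field_simp; ring
  simp only [kE, kKer_of_lt hz.2, kKer_of_lt (hz.2.trans huv)]
  rw [e, ← ENNReal.ofReal_mul (by positivity), ← ENNReal.ofReal_mul (by positivity),
    ← ENNReal.ofReal_mul (by positivity)]
  congr 1
  rw [abs_neg, abs_of_pos (by positivity)]
  apply Real.log_injOn_pos (Set.mem_Ioi.2 (by positivity)) (Set.mem_Ioi.2 (by positivity))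
  have n1 := hu.ne'
  have n2 := hz0.ne'
  have n3 := hz1.ne'
  have n4 := hv.ne'
  have n5 := hz2.ne'
  have n6 := hd.ne'
  have hl : ∀ x y : ℝ, 0 < x → 0 < y → Real.log (x * y) = Real.log x + Real.log y :=
    fun x y hx hy => Real.log_mul hx.ne' hy.ne'
  have hdv : ∀ x y : ℝ, 0 < x → 0 < y → Real.log (x / y) = Real.log x - Real.log y :=
    fun x y hx hy => Real.log_div hx.ne' hy.ne'
  have hp : ∀ x y : ℝ, 0 < x → Real.log (x ^ y) = y * Real.log x :=
    fun x y hx => Real.log_rpow hx y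
  simp (disch := positivity) only [hl, hdv, hp, Real.log_pow]
  push_cast
  ring

lemma lintegral_kE_kE {H' T u v : ℝ} (h1 : 1/2 < H') (h2 : H' < 1) (hu : 0 < u) (hv : 0 < v)
    (huv : u ≠ v) (huT : u ≤ T) (hvT : v ≤ T) :
    ∫⁻ z in Set.Ioo (0:ℝ) T, kE H' u z * kE H' v z =
      ENNReal.ofReal (betaFn (H' - 1/2) (2 - 2 * H') * |u - v| ^ (2 * H' - 2)) := by
  rcases lt_or_gt_of_ne huv with h | h
  · rw [lintegral_kE_kE_aux h1 h2 hu h huT, abs_sub_comm, abs_of_pos (by linarith)]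
  · rw [abs_of_pos (by linarith), ← lintegral_kE_kE_aux h1 h2 hv h hvT]
    simp_rw [mul_comm]

lemma lintegral_pi_prod {μ : Measure ℝ} [SigmaFinite μ] {f : ℝ → ENNReal} (hf : Measurable f)
    (n : ℕ) : ∫⁻ z : Fin n → ℝ, ∏ i, f (z i) ∂(Measure.pi fun _ => μ) = (∫⁻ x, f x ∂μ) ^ n := by
  induction n with
  | zero => simp
  | succ n ih =>
    have hmp := (measurePreserving_piFinSuccAbove (fun _ : Fin (n+1) => μ) 0).symm
    rw [← hmp.lintegral_comp_emb (MeasurableEquiv.measurableEmbedding _),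
      lintegral_prod _ (by
        refine Measurable.aemeasurable ?_
        refine Finset.measurable_prod _ fun i _ => ?_
        exact hf.comp ((measurable_pi_apply i).comp (MeasurableEquiv.measurable _)))]
    simp only [MeasurableEquiv.piFinSuccAbove_symm_apply, Fin.prod_univ_succ]
    simp only [Fin.insertNthEquiv, Equiv.coe_fn_mk, Fin.insertNth_zero', Fin.cons_zero,
      Fin.cons_succ]
    have hm : Measurable (fun y : Fin n → ℝ => ∏ i, f (y i)) :=
      Finset.measurable_prod _ fun i _ => hf.comp (measurable_pi_apply i)
    rw [pow_succ', ← ih]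
    exact lintegral_lintegral_mul hf.aemeasurable hm.aemeasurable

lemma LHq_eq_s8 {H H' τ : ℝ} {q : ℕ} [NeZero q] (hlt : H' < 1) (hH' : H' = 1 + (H - 1)/(q:ℝ))
    (w : Fin q → ℝ) (hw : ∀ i, 0 < w i) :
    LHq H q τ w = cHq H q * ∫ u in Set.Ioo 0 τ, ∏ i, kKer H' u (w i) := by
  have e1 : 1/2 - (1 - H)/(q:ℝ) = H' - 1/2 := by rw [hH']; ring
  have e2 : -(1/2 + (1 - H)/(q:ℝ)) = H' - 3/2 := by rw [hH']; ring
  unfold LHq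
  rw [e1, e2]
  have hne : Nonempty (Fin q) := ⟨0⟩
  by_cases hmem : w ∈ Set.univ.pi fun _ : Fin q => Set.Ioo (0:ℝ) τ
  · rw [Set.indicator_of_mem hmem]
    congr 1
    have hlt' : ∀ i, w i < τ := fun i => (hmem i trivial).2
    obtain ⟨j, hj⟩ := exists_eq_ciSup_of_finite (f := w)
    have hle : ∀ i, w i ≤ ⨆ i, w i := fun i => le_ciSup (Set.finite_range w).bddAbove i
    have hm0 : 0 < ⨆ i, w i := hj ▸ hw j
    have hmτ : (⨆ i, w i) < τ := hj ▸ hlt' j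
    rw [intervalIntegral.integral_of_le hmτ.le, integral_Ioc_eq_integral_Ioo,
      setIntegral_eq_of_subset_of_forall_sdiff_eq_zero measurableSet_Ioo
        (Set.Ioo_subset_Ioo_left hm0.le)]
    · refine setIntegral_congr_fun measurableSet_Ioo fun u hu => ?_
      refine Finset.prod_congr rfl fun i _ => ?_
      rw [kKer_of_lt ((hle i).trans_lt hu.1)]
    · rintro u ⟨hu, hu'⟩
      refine Finset.prod_eq_zero (Finset.mem_univ j) (kKer_eq_zero (by linarith) ?_)
      rw [hj]
      by_contra hcon
      exact hu' ⟨not_le.1 hcon, hu.2⟩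
  · rw [Set.indicator_of_notMem hmem]
    have : ∃ i, τ ≤ w i := by
      by_contra hcon
      push Not at hcon
      exact hmem fun i _ => ⟨hw i, hcon i⟩
    obtain ⟨i, hi⟩ := this
    rw [setIntegral_congr_fun (g := fun _ => (0:ℝ)) measurableSet_Ioo]
    · simp
    · intro u hu
      exact Finset.prod_eq_zero (Finset.mem_univ i) (kKer_eq_zero (by linarith) (hu.2.le.trans hi))

/-- `ENNReal`-valued integral of the product kernel over `(s,t)`. -/
noncomputable def FE (H' s t : ℝ) {n : ℕ} (x : ℝ) (z : Fin n → ℝ) : ENNReal :=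
  ∫⁻ u in Set.Ioo s t, kE H' u x * ∏ i, kE H' u (z i)

lemma measurable_FE_aux (H' : ℝ) (n : ℕ) :
    Measurable (fun p : (ℝ × (Fin n → ℝ)) × ℝ => kE H' p.2 p.1.1 * ∏ i, kE H' p.2 (p.1.2 i)) := by
  fun_prop

lemma measurable_FE (H' s t : ℝ) (n : ℕ) :
    Measurable (fun p : ℝ × (Fin n → ℝ) => FE H' s t p.1 p.2) := by
  unfold FE
  exact (measurable_FE_aux H' n).lintegral_prod_right'

lemma measurable_FE_right (H' s t : ℝ) {n : ℕ} (x : ℝ) :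
    Measurable (fun z : Fin n → ℝ => FE H' s t x z) := by
  unfold FE
  have h : Measurable (fun p : (Fin n → ℝ) × ℝ => kE H' p.2 x * ∏ i, kE H' p.2 (p.1 i)) := by
    fun_prop
  exact h.lintegral_prod_right'

lemma LHq_sub_eq {H H' s t : ℝ} {n : ℕ} (hlt : H' < 1) (hH' : H' = 1 + (H - 1)/((n+1 : ℕ):ℝ))
    (hs : 0 ≤ s) (hst : s < t) (x : ℝ) (hx : 0 < x)
    (z : Fin n → ℝ) (hz : ∀ i, 0 < z i) (hfin : FE H' 0 t x z < ⊤) (w : Fin (n+1) → ℝ)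
    (hw : w = Matrix.vecCons x z) :
    LHq H (n+1) t w - LHq H (n+1) s w = cHq H (n+1) * (FE H' s t x z).toReal := by
  have hwp : ∀ i, 0 < w i := by
    subst hw
    intro i
    refine Fin.cases ?_ (fun j => ?_) i
    · simpa using hx
    · simpa using hz j
  rw [LHq_eq_s8 hlt hH' w hwp, LHq_eq_s8 hlt hH' w hwp, ← mul_sub]
  congr 1
  have hmeas : Measurable (fun u => ∏ i, kKer H' u (w i)) :=
    Finset.measurable_prod _ fun i _ => (measurable_kKer H').comp
      (measurable_id.prodMk measurable_const)
  have hnn : ∀ u, 0 < u → 0 ≤ ∏ i, kKer H' u (w i) := fun u hu =>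
    Finset.prod_nonneg fun i _ => kKer_nonneg hu.le (hwp i).le
  have hof : ∀ u, 0 < u → ENNReal.ofReal (∏ i, kKer H' u (w i))
      = kE H' u x * ∏ i, kE H' u (z i) := by
    intro u hu
    rw [ENNReal.ofReal_prod_of_nonneg fun i _ => kKer_nonneg hu.le (hwp i).le, Fin.prod_univ_succ]
    simp [hw, kE]
  have hFE : ∀ r, 0 ≤ r → ∫⁻ u in Set.Ioo r t, ENNReal.ofReal (∏ i, kKer H' u (w i))
      = FE H' r t x z := fun r hr =>
    setLIntegral_congr_fun measurableSet_Ioo fun u hu => hof u (hr.trans_lt hu.1)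
  have hint : IntegrableOn (fun u => ∏ i, kKer H' u (w i)) (Set.Ioo 0 t) := by
    refine ⟨hmeas.aestronglyMeasurable, ?_⟩
    rw [hasFiniteIntegral_iff_ofReal, hFE 0 le_rfl]
    · exact hfin
    · filter_upwards [ae_restrict_mem measurableSet_Ioo] with u hu using hnn u hu.1
  rw [← hFE s hs, ← integral_eq_lintegral_of_nonneg_ae _ hmeas.aestronglyMeasurable]
  · have hint' : IntervalIntegrable (fun u => ∏ i, kKer H' u (w i)) volume 0 t := by
      rwa [intervalIntegrable_iff_integrableOn_Ioo_of_le (hs.trans hst.le)]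
    rw [← integral_Ioc_eq_integral_Ioo, ← integral_Ioc_eq_integral_Ioo,
      ← integral_Ioc_eq_integral_Ioo, ← intervalIntegral.integral_of_le hst.le,
      ← intervalIntegral.integral_of_le hs, ← intervalIntegral.integral_of_le (hs.trans hst.le)]
    apply intervalIntegral.integral_interval_sub_left hint'
    refine hint'.mono_set ?_
    rw [Set.uIcc_of_le hs, Set.uIcc_of_le (hs.trans hst.le)]
    exact Set.Icc_subset_Icc_right hst.le
  · filter_upwards [ae_restrict_mem measurableSet_Ioo] with u hu using hnn u (hs.trans_lt hu.1)

lemma exists_bound_kE {H' T : ℝ} (h1 : 1/2 < H') (h2 : H' < 1) :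
    ∃ C : ENNReal, C ≠ ⊤ ∧ ∀ u, 0 < u → u ≤ T → ∫⁻ z in Set.Ioo (0:ℝ) T, kE H' u z ≤ C := by
  refine ⟨ENNReal.ofReal (T ^ (H' - 1/2)) * ENNReal.ofReal (betaFn (3/2 - H') (H' - 1/2)),
    by finiteness, fun u hu huT => ?_⟩
  rw [lintegral_kE h1 h2 hu huT]
  gcongr

lemma ae_FE_lt_top {H' t T : ℝ} (h1 : 1/2 < H') (h2 : H' < 1) (ht : t ≤ T) (n : ℕ) :
    ∀ᵐ x ∂(volume.restrict (Set.Ioo (0:ℝ) T)),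
      ∀ᵐ z : Fin n → ℝ ∂(Measure.pi fun _ => volume.restrict (Set.Ioo (0:ℝ) T)),
        FE H' 0 t x z < ⊤ := by
  obtain ⟨C, hC, hb⟩ := exists_bound_kE (T := T) h1 h2
  set μ := volume.restrict (Set.Ioo (0:ℝ) T) with hμ
  set P := (Measure.pi fun _ : Fin n => μ) with hP
  have key : ∫⁻ p, FE H' 0 t p.1 p.2 ∂(μ.prod P) ≠ ⊤ := by
    unfold FE
    rw [lintegral_lintegral_swap (measurable_FE_aux H' n).aemeasurable]
    refine ne_top_of_le_ne_top (b := ∫⁻ u in Set.Ioo 0 t, C * C ^ n) ?_ ?_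
    · simp; finiteness
    · refine setLIntegral_mono' measurableSet_Ioo fun u hu => ?_
      rw [lintegral_prod_mul (f := fun x => kE H' u x) (g := fun z : Fin n → ℝ => ∏ i, kE H' u (z i))
        (Measurable.aemeasurable (by fun_prop)) (Measurable.aemeasurable (by fun_prop)),
        lintegral_pi_prod (f := fun z => kE H' u z) (by fun_prop)]
      have := hb u hu.1 (hu.2.le.trans ht)
      gcongr
  have := ae_lt_top (measurable_FE H' 0 t n) key
  exact Measure.ae_ae_of_ae_prod this

lemma lintegral_abs_rpow_bound {e s t T : ℝ} (he : -1 < e) (hs : 0 ≤ s) (ht : t ≤ T) :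
    ∃ D : ENNReal, D ≠ ⊤ ∧ ∀ u ∈ Set.Ioo s t,
      ∫⁻ v in Set.Ioo s t, ENNReal.ofReal (|u - v| ^ e) ≤ D := by
  refine ⟨∫⁻ w in Set.Ioo (-T) T, ENNReal.ofReal (|w| ^ e), ?_, fun u hu => ?_⟩
  · by_cases hT : T ≤ -T
    · simp [Set.Ioo_eq_empty (not_lt.2 hT)]
    have hT' : -T ≤ T := (not_le.1 hT).le
    have i1 : IntervalIntegrable (fun w : ℝ => w ^ e) volume (-T) T :=
      intervalIntegral.intervalIntegrable_rpow' he
    have i2 : IntervalIntegrable (fun w : ℝ => (-w) ^ e) volume (-T) T := by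
      have := (intervalIntegral.intervalIntegrable_rpow' (a := T) (b := -T) he).comp_sub_left 0
      simpa using this
    rw [intervalIntegrable_iff_integrableOn_Ioo_of_le hT'] at i1 i2
    refine ne_top_of_le_ne_top (b := ∫⁻ w in Set.Ioo (-T) T,
      (ENNReal.ofReal (w ^ e) + ENNReal.ofReal ((-w) ^ e))) ?_ (lintegral_mono fun w => ?_)
    · rw [lintegral_add_left (by fun_prop)]
      exact ENNReal.add_ne_top.2 ⟨i1.lintegral_lt_top.ne, i2.lintegral_lt_top.ne⟩
    · rcases le_total 0 w with h | h
      · rw [abs_of_nonneg h]; exact le_self_add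
      · rw [abs_of_nonpos h]; exact le_add_self
  · have : ∫⁻ v in Set.Ioo s t, ENNReal.ofReal (|u - v| ^ e)
        = ∫⁻ w in (fun v => u - v) '' Set.Ioo s t, ENNReal.ofReal (|w| ^ e) := by
      rw [lintegral_image_eq_lintegral_abs_deriv_mul (f := fun v => u - v)
        (f' := fun _ => (0 - 1:ℝ)) measurableSet_Ioo
        (fun x _ => ((hasDerivAt_const x u).sub (hasDerivAt_id x)).hasDerivWithinAt)]
      · simp
      · intro a _ b _ h
        simpa using h
    rw [this]
    refine lintegral_mono_set ?_
    rintro _ ⟨v, hv, rfl⟩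
    constructor <;> simp only <;> linarith [hv.1, hv.2, hu.1, hu.2]

lemma fubini_FE {H' s t : ℝ} {μ : Measure ℝ} [SigmaFinite μ] (n : ℕ) (x y : ℝ) :
    ∫⁻ z : Fin n → ℝ, FE H' s t x z * FE H' s t y z ∂(Measure.pi fun _ => μ) =
      ∫⁻ u in Set.Ioo s t, ∫⁻ v in Set.Ioo s t,
        kE H' u x * kE H' v y * (∫⁻ z, kE H' u z * kE H' v z ∂μ) ^ n := by
  have h1 : ∀ z : Fin n → ℝ, FE H' s t x z * FE H' s t y z =
      ∫⁻ u in Set.Ioo s t, ∫⁻ v in Set.Ioo s t,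
        (kE H' u x * ∏ i, kE H' u (z i)) * (kE H' v y * ∏ i, kE H' v (z i)) := by
    intro z
    unfold FE
    rw [lintegral_lintegral_mul (f := fun u => kE H' u x * ∏ i, kE H' u (z i))
      (g := fun u => kE H' u y * ∏ i, kE H' u (z i))
      (Measurable.aemeasurable (by fun_prop)) (Measurable.aemeasurable (by fun_prop))]
  simp_rw [h1]
  have hm3 : Measurable (fun p : ((Fin n → ℝ) × ℝ) × ℝ =>
      (kE H' p.1.2 x * ∏ i, kE H' p.1.2 (p.1.1 i)) * (kE H' p.2 y * ∏ i, kE H' p.2 (p.1.1 i))) := by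
    fun_prop
  rw [lintegral_lintegral_swap hm3.lintegral_prod_right'.aemeasurable]
  refine lintegral_congr fun u => ?_
  have hm2 : Measurable (fun p : (Fin n → ℝ) × ℝ =>
      (kE H' u x * ∏ i, kE H' u (p.1 i)) * (kE H' p.2 y * ∏ i, kE H' p.2 (p.1 i))) := by
    fun_prop
  rw [lintegral_lintegral_swap hm2.aemeasurable]
  refine lintegral_congr fun v => ?_
  have h2 : ∀ z : Fin n → ℝ,
      (kE H' u x * ∏ i, kE H' u (z i)) * (kE H' v y * ∏ i, kE H' v (z i))
      = (kE H' u x * kE H' v y) * ∏ i, (kE H' u (z i) * kE H' v (z i)) := by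
    intro z
    rw [Finset.prod_mul_distrib]
    ring
  simp_rw [h2]
  rw [lintegral_const_mul _ (by fun_prop),
    lintegral_pi_prod (f := fun z => kE H' u z * kE H' v z) (by fun_prop)]

lemma ae_inner_lt_top {H' s t T e : ℝ} (h1 : 1/2 < H') (h2 : H' < 1) (he : -1 < e)
    (hs : 0 ≤ s) (ht : t ≤ T) :
    ∀ᵐ y ∂(volume.restrict (Set.Ioo (0:ℝ) T)), ∀ᵐ u ∂(volume.restrict (Set.Ioo s t)),
      ∫⁻ v in Set.Ioo s t, kE H' v y * ENNReal.ofReal (|u - v| ^ e) < ⊤ := by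
  obtain ⟨C, hC, hb⟩ := exists_bound_kE (T := T) h1 h2
  obtain ⟨D, hD, hd⟩ := lintegral_abs_rpow_bound he hs ht
  have hm3 : Measurable (fun p : (ℝ × ℝ) × ℝ =>
      kE H' p.2 p.1.1 * ENNReal.ofReal (|p.1.2 - p.2| ^ e)) := by
    fun_prop
  have hm := hm3.lintegral_prod_right' (ν := volume.restrict (Set.Ioo s t))
  refine Measure.ae_ae_of_ae_prod (ae_lt_top hm ?_)
  rw [lintegral_prod_symm _ hm.aemeasurable]
  refine ne_top_of_le_ne_top (b := ∫⁻ u in Set.Ioo s t, C * D) ?_ ?_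
  · simp; finiteness
  · refine setLIntegral_mono' measurableSet_Ioo fun u hu => ?_
    have hm2 : Measurable (fun p : ℝ × ℝ =>
      kE H' p.2 p.1 * ENNReal.ofReal (|u - p.2| ^ e)) := by fun_prop
    simp only
    rw [lintegral_lintegral_swap hm2.aemeasurable]
    calc _ ≤ ∫⁻ v in Set.Ioo s t, C * ENNReal.ofReal (|u - v| ^ e) := by
          refine setLIntegral_mono' measurableSet_Ioo fun v hv => ?_
          rw [lintegral_mul_const _ (by fun_prop)]
          gcongr
          exact hb v (hs.trans_lt hv.1) (hv.2.le.trans ht)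
      _ ≤ C * D := by
          rw [lintegral_const_mul _ (by fun_prop)]
          gcongr
          exact hd u hu

lemma rhs_eq {H' s t e x y : ℝ} (hs : 0 ≤ s) (hx : 0 < x) (hy : 0 < y)
    (hfin : ∀ᵐ u ∂(volume.restrict (Set.Ioo s t)),
      ∫⁻ v in Set.Ioo s t, kE H' v y * ENNReal.ofReal (|u - v| ^ e) < ⊤) :
    (∫ u in Set.Ioo s t, ∫ v in Set.Ioo s t, kKer H' u x * kKer H' v y * |u - v| ^ e) =
      (∫⁻ u in Set.Ioo s t, ∫⁻ v in Set.Ioo s t,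
        kE H' u x * kE H' v y * ENNReal.ofReal (|u - v| ^ e)).toReal := by
  have hm2 : Measurable (fun p : ℝ × ℝ =>
      kE H' p.1 x * kE H' p.2 y * ENNReal.ofReal (|p.1 - p.2| ^ e)) := by fun_prop
  rw [← integral_toReal hm2.lintegral_prod_right'.aemeasurable]
  · refine setIntegral_congr_fun measurableSet_Ioo fun u hu => ?_
    have hm1 : Measurable (fun v : ℝ =>
      kE H' u x * kE H' v y * ENNReal.ofReal (|u - v| ^ e)) := by fun_prop
    simp only
    rw [← integral_toReal hm1.aemeasurable
      (Filter.Eventually.of_forall fun v => by unfold kE; finiteness)]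
    refine setIntegral_congr_fun measurableSet_Ioo fun v hv => ?_
    have hu0 : 0 ≤ u := hs.trans hu.1.le
    have hv0 : 0 ≤ v := hs.trans hv.1.le
    simp only [kE, ENNReal.toReal_mul]
    rw [ENNReal.toReal_ofReal (kKer_nonneg hu0 hx.le), ENNReal.toReal_ofReal (kKer_nonneg hv0 hy.le),
      ENNReal.toReal_ofReal (by positivity)]
  · filter_upwards [hfin] with u hu
    simp only [mul_assoc]
    rw [lintegral_const_mul _ (by fun_prop)]
    exact ENNReal.mul_lt_top (by simp [kE]) hu

lemma core_lintegral {H' s t T e x y : ℝ} {n : ℕ} (h1 : 1/2 < H') (h2 : H' < 1)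
    (he : e = (2 * H' - 2) * n) (hs : 0 ≤ s) (ht : t ≤ T) :
    (∫⁻ z : Fin n → ℝ, FE H' s t x z * FE H' s t y z
        ∂(Measure.pi fun _ => volume.restrict (Set.Ioo (0:ℝ) T))) =
      ENNReal.ofReal (betaFn (H' - 1/2) (2 - 2 * H') ^ n) *
      ∫⁻ u in Set.Ioo s t, ∫⁻ v in Set.Ioo s t,
        kE H' u x * kE H' v y * ENNReal.ofReal (|u - v| ^ e) := by
  have hB := betaFn_nonneg (H' - 1/2) (2 - 2 * H')
  rw [fubini_FE, ← lintegral_const_mul' _ _ ENNReal.ofReal_ne_top]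
  refine setLIntegral_congr_fun measurableSet_Ioo fun u hu => ?_
  rw [← lintegral_const_mul' _ _ ENNReal.ofReal_ne_top]
  refine lintegral_congr_ae ?_
  have hne : ∀ᵐ v ∂(volume.restrict (Set.Ioo s t)), v ≠ u :=
    ae_restrict_of_ae (Measure.ae_ne volume u)
  filter_upwards [ae_restrict_mem measurableSet_Ioo, hne] with v hv hvu
  rw [lintegral_kE_kE h1 h2 (hs.trans_lt hu.1) (hs.trans_lt hv.1) hvu.symm (hu.2.le.trans ht)
    (hv.2.le.trans ht), ← ENNReal.ofReal_pow (by positivity), mul_pow, he,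
    Real.rpow_mul_natCast (abs_nonneg _), ENNReal.ofReal_mul (by positivity)]
  ring

lemma main_aux_s8 (T H : ℝ) (hH : H ∈ Set.Ioo (1/2:ℝ) 1)
    (n : ℕ) (hn : 1 ≤ n) (H' : ℝ) (hH' : H' = 1 + (H - 1)/((n + 1 : ℕ):ℝ))
    (s t : ℝ) (hs : 0 ≤ s) (hst : s < t) (ht : t ≤ T) (V : ℝ → (Fin n → ℝ) → (Fin (n+1) → ℝ))
    (hV : ∀ x z, V x z = Matrix.vecCons x z) :
    ∀ᵐ p : ℝ × ℝ ∂(volume.restrict (Set.Icc (0:ℝ) T ×ˢ Set.Icc (0:ℝ) T)),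
      (∫ z : Fin n → ℝ in Set.univ.pi fun _ => Set.Icc (0:ℝ) T,
        (LHq H (n+1) t (V p.1 z) - LHq H (n+1) s (V p.1 z)) *
        (LHq H (n+1) t (V p.2 z) - LHq H (n+1) s (V p.2 z))) =
      cHq H (n+1) ^ 2 * betaFn (H' - 1/2) (2 - 2*H') ^ n *
        (∫ u in Set.Ioo s t, ∫ v in Set.Ioo s t,
          kKer H' u p.1 * kKer H' v p.2 * |u - v| ^ ((2*H' - 2) * (((n+1 : ℕ):ℝ) - 1))) := by
  have hn1 : (1:ℝ) ≤ n := by exact_mod_cast hn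
  have hq : (0:ℝ) < (n:ℝ) + 1 := by linarith
  have hmul : (H' - 1) * (n + 1) = H - 1 := by rw [hH']; push_cast; field_simp; ring
  obtain ⟨hHa, hHb⟩ := hH
  have h2 : H' < 1 := by nlinarith
  have h1 : 1/2 < H' := by nlinarith
  set e := (2*H' - 2) * (((n+1 : ℕ):ℝ) - 1) with hedef
  have he : e = (2 * H' - 2) * n := by rw [hedef]; push_cast; ring
  have he1 : -1 < e := by rw [he]; nlinarith
  have hIcc : volume.restrict (Set.Icc (0:ℝ) T) = volume.restrict (Set.Ioo (0:ℝ) T) :=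
    Measure.restrict_congr_set Ioo_ae_eq_Icc.symm
  rw [Measure.volume_eq_prod, ← Measure.prod_restrict, volume_pi, Measure.restrict_pi_pi, hIcc]
  set μ := volume.restrict (Set.Ioo (0:ℝ) T) with hμ
  have hpos : ∀ᵐ x ∂μ, 0 < x := by
    filter_upwards [ae_restrict_mem measurableSet_Ioo] with x hx using hx.1
  have hposz : ∀ᵐ z ∂(Measure.pi fun _ : Fin n => μ), ∀ i, 0 < z i :=
    ae_all_iff.2 fun i => Measure.tendsto_eval_ae_ae.eventually hpos
  have hF := ae_FE_lt_top h1 h2 ht n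
  have hI := ae_inner_lt_top h1 h2 he1 hs ht
  have hg : ∀ᵐ x ∂μ, 0 < x ∧ (∀ᵐ z ∂(Measure.pi fun _ : Fin n => μ), FE H' 0 t x z < ⊤) ∧
      ∀ᵐ u ∂(volume.restrict (Set.Ioo s t)),
        ∫⁻ v in Set.Ioo s t, kE H' v x * ENNReal.ofReal (|u - v| ^ e) < ⊤ := by
    filter_upwards [hpos, hF, hI] with x a b c using ⟨a, b, c⟩
  filter_upwards [Measure.quasiMeasurePreserving_fst.ae hg,
    Measure.quasiMeasurePreserving_snd.ae hg] with p hp1 hp2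
  obtain ⟨x, y⟩ := p
  obtain ⟨hx, hFx, -⟩ := hp1
  obtain ⟨hy, hFy, hIy⟩ := hp2
  simp only at hx hFx hy hFy hIy ⊢
  have hmono : ∀ (x : ℝ) (z : Fin n → ℝ), FE H' 0 t x z < ⊤ → FE H' s t x z < ⊤ := fun x z h =>
    (lintegral_mono_set (Set.Ioo_subset_Ioo_left hs)).trans_lt h
  rw [rhs_eq hs hx hy hIy]
  have hcore := congrArg ENNReal.toReal
    (core_lintegral (x := x) (y := y) (n := n) h1 h2 he hs ht)
  rw [ENNReal.toReal_mul, ENNReal.toReal_ofReal (pow_nonneg (betaFn_nonneg _ _) _)] at hcore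
  have hmm : Measurable (fun z : Fin n → ℝ => FE H' s t x z * FE H' s t y z) :=
    (measurable_FE_right H' s t x).mul (measurable_FE_right H' s t y)
  rw [mul_assoc, ← hcore, ← integral_toReal hmm.aemeasurable,
    ← integral_const_mul]
  · refine integral_congr_ae ?_
    filter_upwards [hposz, hFx, hFy] with z hz hzx hzy
    rw [LHq_sub_eq h2 hH' hs hst x hx z hz hzx _ (hV x z),
      LHq_sub_eq h2 hH' hs hst y hy z hz hzy _ (hV y z), ENNReal.toReal_mul]
    ring
  · filter_upwards [hFx, hFy] with z hzx hzy
    exact ENNReal.mul_lt_top (hmono x z hzx) (hmono y z hzy)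

/-- The `(q-1)`-fold contraction of the increment kernel `L_{s,t}^{H,q}` with itself:
for a.e. `(x,y) ∈ [0,T]²`,
`∫_{[0,T]^{q-1}} L_{s,t}^{H,q}(x,z) L_{s,t}^{H,q}(y,z) dz
 = c_{H,q}² B(H'-1/2, 2-2H')^{q-1} ∫_s^t ∫_s^t k^{H'}(u,x) k^{H'}(v,y) |u-v|^{(2H'-2)(q-1)} du dv`. -/
theorem stmt_8 (T H : ℝ) (hT : 0 < T) (hH : H ∈ Set.Ioo (1/2:ℝ) 1)
    (q : ℕ) (hq : 2 ≤ q) (H' : ℝ) (hH' : H' = 1 + (H - 1)/(q:ℝ))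
    (s t : ℝ) (hs : 0 ≤ s) (hst : s < t) (ht : t ≤ T) :
    ∀ᵐ p : ℝ × ℝ ∂(volume.restrict (Set.Icc (0:ℝ) T ×ˢ Set.Icc (0:ℝ) T)),
      (∫ z : Fin (q - 1) → ℝ in Set.univ.pi fun _ => Set.Icc (0:ℝ) T,
        (LHq H q t (consVec (by omega) p.1 z) - LHq H q s (consVec (by omega) p.1 z)) *
        (LHq H q t (consVec (by omega) p.2 z) - LHq H q s (consVec (by omega) p.2 z))) =
      cHq H q ^ 2 * betaFn (H' - 1/2) (2 - 2*H') ^ (q - 1) *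
        (∫ u in Set.Ioo s t, ∫ v in Set.Ioo s t,
          kKer H' u p.1 * kKer H' v p.2 * |u - v| ^ ((2*H' - 2) * ((q:ℝ) - 1))) := by
  obtain ⟨n, rfl⟩ : ∃ n, q = n + 1 := ⟨q - 1, by omega⟩
  exact main_aux_s8 T H hH n (by omega) H' hH' s t hs hst ht
    (fun x z => consVec (q := n + 1) (by omega) x z) (fun x z => rfl)
end
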